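/- In the ring of formal power series ℚ⟦z⟧, the generating function of the partial sums of squares of Tetranacci numbers satisfies ∑_{n≥0} (∑_{k=0}^{n} u_k²) z^n = z · (3(1−z))⁻¹ + (2z + z² − z³ − z⁴ + 5z⁵ + 4z⁶ + z⁷ + z⁸ − z⁹ − z¹⁰) · (3(1 − 2z − 4z² − 6z³ − 12z⁴ + 4z⁵ + 6z⁶ + 2z⁸ − z¹⁰))⁻¹, where the inverses are the multiplicative inverses of these power series (which exist since their constant terms are nonzero). -/

import Mathlib

/-- The Tetranacci numbers: u 0 = 0, u 1 = 1, u 2 = 1, u 3 = 2 and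
    u (n+4) = u (n+3) + u (n+2) + u (n+1) + u n. -/
def tetra : ℕ → ℤ
  | 0 => 0
  | 1 => 1
  | 2 => 1
  | 3 => 2
  | n + 4 => tetra (n + 3) + tetra (n + 2) + tetra (n + 1) + tetra n

open PowerSeries in
theorem tetra_sq_aux :
    (1 - 2 * X - 4 * X ^ 2 - 6 * X ^ 3 - 12 * X ^ 4 + 4 * X ^ 5
            + 6 * X ^ 6 + 2 * X ^ 8 - X ^ 10 : PowerSeries ℚ)
      * PowerSeries.mk (fun n => (tetra n : ℚ) ^ 2)
    = X - X ^ 2 - 2 * X ^ 3 - 2 * X ^ 4 - 2 * X ^ 5 + X ^ 6 + X ^ 7 := by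
  have h2 : (2 : PowerSeries ℚ) = C 2 := (map_ofNat C 2).symm
  have h4 : (4 : PowerSeries ℚ) = C 4 := (map_ofNat C 4).symm
  have h6 : (6 : PowerSeries ℚ) = C 6 := (map_ofNat C 6).symm
  have h12 : (12 : PowerSeries ℚ) = C 12 := (map_ofNat C 12).symm
  have hX : (X : PowerSeries ℚ) = X ^ 1 := (pow_one X).symm
  ext n
  rw [h2, h4, h6, h12, hX]
  simp only [← pow_mul, one_mul, sub_mul, add_mul, mul_assoc, map_sub, map_add, coeff_C_mul,
    coeff_X_pow_mul', coeff_X_pow, coeff_mk]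
  by_cases hn : n < 10
  · interval_cases n <;> norm_num [tetra]
  · obtain ⟨m, rfl⟩ : ∃ m, n = m + 10 := ⟨n - 10, by omega⟩
    have e : ∀ k, k ≤ 10 → (k ≤ m + 10 ∧ m + 10 - k = m + (10 - k)) := fun k hk => by omega
    have r : ∀ j, (tetra (j + 4) : ℚ) = tetra (j + 3) + tetra (j + 2) + tetra (j + 1) + tetra j := by
      intro j
      rw [tetra]
      push_cast
      ring
    rw [if_pos (e 1 (by norm_num)).1, if_pos (e 2 (by norm_num)).1, if_pos (e 3 (by norm_num)).1,
      if_pos (e 4 (by norm_num)).1, if_pos (e 5 (by norm_num)).1, if_pos (e 6 (by norm_num)).1,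
      if_pos (e 8 (by norm_num)).1, if_pos (e 10 (by norm_num)).1,
      (e 1 (by norm_num)).2, (e 2 (by norm_num)).2, (e 3 (by norm_num)).2,
      (e 4 (by norm_num)).2, (e 5 (by norm_num)).2, (e 6 (by norm_num)).2,
      (e 8 (by norm_num)).2, (e 10 (by norm_num)).2]
    have z : ∀ k, k < 10 → ¬ (m + 10 = k) := fun k hk => by omega
    rw [if_neg (z 1 (by norm_num)), if_neg (z 2 (by norm_num)), if_neg (z 3 (by norm_num)),
      if_neg (z 4 (by norm_num)), if_neg (z 5 (by norm_num)), if_neg (z 6 (by norm_num)),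
      if_neg (z 7 (by norm_num))]
    have r0 := r m
    have r1 := r (m + 1)
    have r2 := r (m + 2)
    have r3 := r (m + 3)
    have r4 := r (m + 4)
    have r5 := r (m + 5)
    have r6 := r (m + 6)
    simp only [add_assoc] at r0 r1 r2 r3 r4 r5 r6
    norm_num at r0 r1 r2 r3 r4 r5 r6 ⊢
    rw [r6, r5, r4, r3, r2, r1, r0]
    ring

open PowerSeries in
theorem tetra_sum_aux :
    (1 - X : PowerSeries ℚ)
      * PowerSeries.mk (fun n => ∑ k ∈ Finset.range (n + 1), (tetra k : ℚ) ^ 2)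
    = PowerSeries.mk (fun n => (tetra n : ℚ) ^ 2) := by
  ext n
  rw [sub_mul, one_mul, map_sub]
  cases n with
  | zero => simp
  | succ n =>
    rw [coeff_succ_X_mul, coeff_mk, coeff_mk, coeff_mk, Finset.sum_range_succ]
    ring

open PowerSeries in
theorem tetra_partial_sums_sq_genfun :
    PowerSeries.mk (fun n => ∑ k ∈ Finset.range (n + 1), (tetra k : ℚ) ^ 2)
    = X * (3 * (1 - X) : PowerSeries ℚ)⁻¹
      + (2 * X + X ^ 2 - X ^ 3 - X ^ 4 + 5 * X ^ 5 + 4 * X ^ 6 + X ^ 7 + X ^ 8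
          - X ^ 9 - X ^ 10)
        * (3 * (1 - 2 * X - 4 * X ^ 2 - 6 * X ^ 3 - 12 * X ^ 4 + 4 * X ^ 5
            + 6 * X ^ 6 + 2 * X ^ 8 - X ^ 10) : PowerSeries ℚ)⁻¹ := by
  have hA := tetra_sum_aux
  have hB := tetra_sq_aux
  rw [← hA] at hB
  generalize PowerSeries.mk (fun n => ∑ k ∈ Finset.range (n + 1), (tetra k : ℚ) ^ 2) = F at hB ⊢
  have h3 : constantCoeff (3 : PowerSeries ℚ) = 3 := map_ofNat constantCoeff 3
  have c1 : constantCoeff (3 * (1 - X) : PowerSeries ℚ) ≠ 0 := by simp [h3]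
  have c2 : constantCoeff (3 * (1 - 2 * X - 4 * X ^ 2 - 6 * X ^ 3 - 12 * X ^ 4 + 4 * X ^ 5
            + 6 * X ^ 6 + 2 * X ^ 8 - X ^ 10) : PowerSeries ℚ) ≠ 0 := by simp [h3]
  have i1 := PowerSeries.mul_inv_cancel _ c1
  have i2 := PowerSeries.mul_inv_cancel _ c2
  have n1 : (3 * (1 - X) : PowerSeries ℚ) ≠ 0 := fun h => c1 (by rw [h, map_zero])
  have n2 : (3 * (1 - 2 * X - 4 * X ^ 2 - 6 * X ^ 3 - 12 * X ^ 4 + 4 * X ^ 5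
            + 6 * X ^ 6 + 2 * X ^ 8 - X ^ 10) : PowerSeries ℚ) ≠ 0 :=
    fun h => c2 (by rw [h, map_zero])
  apply mul_left_cancel₀ (mul_ne_zero n1 n2)
  generalize (3 * (1 - X) : PowerSeries ℚ)⁻¹ = I at i1 ⊢
  generalize (3 * (1 - 2 * X - 4 * X ^ 2 - 6 * X ^ 3 - 12 * X ^ 4 + 4 * X ^ 5
            + 6 * X ^ 6 + 2 * X ^ 8 - X ^ 10) : PowerSeries ℚ)⁻¹ = J at i2 ⊢
  clear c1 c2 n1 n2 hA
  linear_combination 9 * hB - X * (3 * (1 - 2 * X - 4 * X ^ 2 - 6 * X ^ 3 - 12 * X ^ 4 + 4 * X ^ 5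
            + 6 * X ^ 6 + 2 * X ^ 8 - X ^ 10)) * i1
    - (2 * X + X ^ 2 - X ^ 3 - X ^ 4 + 5 * X ^ 5 + 4 * X ^ 6 + X ^ 7 + X ^ 8
          - X ^ 9 - X ^ 10) * (3 * (1 - X)) * i2
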